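/- Let p and q be probability measures on ℝ, and let Q_p, Q_q : (0,1) → ℝ be differentiable maps with strictly positive derivatives such that the pushforward of Lebesgue measure on (0,1) under Q_p is p and under Q_q is q. Let T : ℝ → ℝ be a differentiable map with T(Q_q(y)) = Q_p(y) for all y ∈ (0,1). Assume the integrands below are integrable. Then ∫ (T'(x) − log T'(x) − 1) dq(x) = ∫₀¹ ( Q_p'(y)/Q_q'(y) − log( Q_p'(y)/Q_q'(y) ) − 1 ) dy. -/

import Mathlib

open MeasureTheory

/-- One-dimensional closed form of the transport KL divergence:
`∫ (T' − log T' − 1) dq = ∫₀¹ (Q_p'/Q_q' − log(Q_p'/Q_q') − 1) dy`, where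
`Q_p, Q_q` are quantile parametrizations of `p, q` and `T∘Q_q = Q_p`. -/
theorem stmt_10 (p q : Measure ℝ) [IsProbabilityMeasure p] [IsProbabilityMeasure q]
    (Qp Qq Qp' Qq' : ℝ → ℝ)
    (hQp : ∀ y ∈ Set.Ioo (0:ℝ) 1, HasDerivAt Qp (Qp' y) y)
    (hQq : ∀ y ∈ Set.Ioo (0:ℝ) 1, HasDerivAt Qq (Qq' y) y)
    (hQp'pos : ∀ y ∈ Set.Ioo (0:ℝ) 1, 0 < Qp' y)
    (hQq'pos : ∀ y ∈ Set.Ioo (0:ℝ) 1, 0 < Qq' y)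
    (hpushp : (volume.restrict (Set.Ioo (0:ℝ) 1)).map Qp = p)
    (hpushq : (volume.restrict (Set.Ioo (0:ℝ) 1)).map Qq = q)
    (T T' : ℝ → ℝ) (hT : ∀ x, HasDerivAt T (T' x) x)
    (hTQ : ∀ y ∈ Set.Ioo (0:ℝ) 1, T (Qq y) = Qp y)
    (hiq : Integrable (fun x => T' x - Real.log (T' x) - 1) q)
    (hi01 : IntegrableOn
      (fun y => Qp' y / Qq' y - Real.log (Qp' y / Qq' y) - 1) (Set.Ioo 0 1)) :
    ∫ x, (T' x - Real.log (T' x) - 1) ∂q =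
      ∫ y in Set.Ioo (0:ℝ) 1,
        (Qp' y / Qq' y - Real.log (Qp' y / Qq' y) - 1) := by
  have hT' : Measurable T' := by
    have h : T' = deriv T := funext fun x => (hT x).deriv.symm
    rw [h]
    exact measurable_deriv T
  have hQqm : AEMeasurable Qq (volume.restrict (Set.Ioo (0:ℝ) 1)) :=
    ContinuousOn.aemeasurable
      (fun y hy => (hQq y hy).continuousAt.continuousWithinAt) measurableSet_Ioo
  have hm : Measurable fun x => T' x - Real.log (T' x) - 1 :=
    (hT'.sub hT'.log).sub_const 1
  rw [← hpushq, integral_map hQqm hm.aestronglyMeasurable]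
  refine setIntegral_congr_fun measurableSet_Ioo fun y hy => ?_
  have hchain : HasDerivAt Qp (T' (Qq y) * Qq' y) y := by
    refine ((hT (Qq y)).comp y (hQq y hy)).congr_of_eventuallyEq ?_
    filter_upwards [Ioo_mem_nhds hy.1 hy.2] with z hz
    exact (hTQ z hz).symm
  have hratio : T' (Qq y) = Qp' y / Qq' y := by
    rw [eq_div_iff (hQq'pos y hy).ne']
    exact hchain.unique (hQp y hy)
  simp only [hratio]
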